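/- The algorithm alg is monotone for unit-size jobs: let a and a' be arrival sequences that are identical except that a'(t₀) = a(t₀) + 1 for a single time t₀ (one extra job in a'), and suppose no jobs arrive after time t₀ in either sequence (a(τ) = a'(τ) = 0 for τ > t₀). If n and n' denote the backlogs of alg run on a and on a' respectively, then n(t) ≤ n'(t) for every t. -/

import Mathlib

open scoped BigOperators ENNReal

/-- Cumulative arrivals up to and including slot `t`. -/
def cumA (a : ℕ → ℕ) (t : ℕ) : ℕ := ∑ τ ∈ Finset.range (t + 1), a τ

/-- Cumulative service strictly before slot `t`. -/
def cumS (s : ℕ → ℕ) (t : ℕ) : ℕ := ∑ τ ∈ Finset.range t, s τ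

/-- Backlog (number of outstanding unit-size jobs) of schedule `s` at slot `t`. -/
def backlog (a s : ℕ → ℕ) (t : ℕ) : ℕ := cumA a t - cumS s t

/-- A schedule is feasible if it never serves more jobs than are outstanding. -/
def Feasible (a s : ℕ → ℕ) : Prop := ∀ t, s t ≤ backlog a s t

/-- Finite support of the arrival sequence. -/
def FinSupp (a : ℕ → ℕ) : Prop := ∃ T, ∀ t, T < t → a t = 0

/-- `s (t-1)` with the convention `s (-1) = 0`. -/
def sPrev (s : ℕ → ℕ) : ℕ → ℕ
  | 0 => 0
  | t + 1 => s t

/-- Flow time plus linear switching cost, with weight `α`. -/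
noncomputable def costLin (α : ℝ) (a s : ℕ → ℕ) : ℝ≥0∞ :=
  (∑' t, (backlog a s t : ℝ≥0∞)) +
    ENNReal.ofReal α * ∑' t, (((s t : ℤ) - (sPrev s t : ℤ)).natAbs : ℝ≥0∞)

/-- Flow time plus quadratic switching cost, with weight `α`. -/
noncomputable def costQuad (α : ℝ) (a s : ℕ → ℕ) : ℝ≥0∞ :=
  (∑' t, (backlog a s t : ℝ≥0∞)) +
    ENNReal.ofReal α * ∑' t, ((((s t : ℤ) - (sPrev s t : ℤ)).natAbs ^ 2 : ℕ) : ℝ≥0∞)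

/-- State machine of an online algorithm: the state at slot `t` is the pair
`(backlog at t, number of active servers at t)`, where the number of active
servers is `g` applied to the current backlog and the previous action
(with the convention that the action at slot `-1` is `0`). -/
def algState (a : ℕ → ℕ) (g : ℕ → ℕ → ℕ) : ℕ → ℕ × ℕ
  | 0 => (a 0, g (a 0) 0)
  | t + 1 =>
      let p := algState a g t
      let n := p.1 - p.2 + a (t + 1)
      (n, g n p.2)

/-- The schedule produced by the online rule `g` on arrival sequence `a`. -/
def algSched (a : ℕ → ℕ) (g : ℕ → ℕ → ℕ) (t : ℕ) : ℕ := (algState a g t).2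

/-- The rule of `alg` with parameters `α ≥ 1`, `β ≥ 1`:
`s(t) = min {n(t), ⌈β·√(n(t)/α)⌉}`. -/
noncomputable def algRule (α β : ℝ) : ℕ → ℕ → ℕ :=
  fun n _ => min n ⌈β * Real.sqrt ((n : ℝ) / α)⌉₊

/-- The backlog of the schedule of a feasible rule is the backlog tracked by its state machine. -/
lemma backlog_algSched (a : ℕ → ℕ) (g : ℕ → ℕ → ℕ) (hg : ∀ n p, g n p ≤ n) (t : ℕ) :
    backlog a (algSched a g) t = (algState a g t).1 := by
  have served_le : ∀ t, (algState a g t).2 ≤ (algState a g t).1 := by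
    intro t
    cases t <;> exact hg _ _
  have cumA_eq : cumA a t = (algState a g t).1 + cumS (algSched a g) t := by
    induction t with
    | zero => simp [cumA, cumS, algState]
    | succ t ih =>
      have hA : cumA a (t + 1) = cumA a t + a (t + 1) := Finset.sum_range_succ _ _
      have hS : cumS (algSched a g) (t + 1) = cumS (algSched a g) t + (algState a g t).2 :=
        Finset.sum_range_succ _ _
      have hn : (algState a g (t + 1)).1 =
          (algState a g t).1 - (algState a g t).2 + a (t + 1) := rfl
      have := served_le t
      omega
  rw [backlog, cumA_eq, Nat.add_sub_cancel]

/-- One more job raises the speed of `alg` by at most one while that speed is below the backlog. -/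
lemma speed_succ_le {α β : ℝ} (hα : 0 ≤ α) (hβ : 0 ≤ β) {n : ℕ}
    (h : β * Real.sqrt ((n : ℝ) / α) < n) :
    β * Real.sqrt (((n + 1 : ℕ) : ℝ) / α) ≤ β * Real.sqrt ((n : ℝ) / α) + 1 := by
  have hx : 0 ≤ β * Real.sqrt ((n : ℝ) / α) := by positivity
  have hn : (0 : ℝ) < n := hx.trans_lt h
  have hc : 0 ≤ β ^ 2 / α := by positivity
  have hx2 : (β * Real.sqrt ((n : ℝ) / α)) ^ 2 = β ^ 2 / α * n := by
    rw [mul_pow, Real.sq_sqrt (by positivity)]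
    ring
  have hy2 : (β * Real.sqrt (((n + 1 : ℕ) : ℝ) / α)) ^ 2 = β ^ 2 / α * (n + 1) := by
    rw [mul_pow, Real.sq_sqrt (by positivity)]
    push_cast
    ring
  generalize β * Real.sqrt ((n : ℝ) / α) = x at *
  generalize β * Real.sqrt (((n + 1 : ℕ) : ℝ) / α) = y at *
  generalize β ^ 2 / α = c at *
  have hcn : c ≤ n := by
    by_contra! hlt
    nlinarith
  have hcx : c ≤ x := by
    refine abs_le_of_sq_le_sq' ?_ hx |>.2
    nlinarith
  exact (abs_le_of_sq_le_sq' (by nlinarith) (by linarith)).2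

/-- The number of jobs that `alg` leaves unserved is monotone in the backlog. -/
lemma monotone_sub_algRule {α β : ℝ} (hα : 0 ≤ α) (hβ : 0 ≤ β) (p : ℕ) :
    Monotone fun n => n - algRule α β n p := by
  refine monotone_nat_of_le_succ fun n => ?_
  simp only [algRule]
  rcases lt_or_ge (β * Real.sqrt ((n : ℝ) / α)) n with h | h
  · have hceil : ⌈β * Real.sqrt (((n + 1 : ℕ) : ℝ) / α)⌉₊ ≤ ⌈β * Real.sqrt ((n : ℝ) / α)⌉₊ + 1 := by
      rw [Nat.ceil_le]
      push_cast
      have := speed_succ_le hα hβ h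
      push_cast at this
      linarith [Nat.le_ceil (β * Real.sqrt ((n : ℝ) / α))]
    omega
  · have : n ≤ ⌈β * Real.sqrt ((n : ℝ) / α)⌉₊ := by
      exact_mod_cast h.trans (Nat.le_ceil _)
    omega

/-- The backlog of `alg` is monotone in the arrival sequence. -/
lemma algState_algRule_mono {α β : ℝ} (hα : 0 ≤ α) (hβ : 0 ≤ β) {a a' : ℕ → ℕ}
    (h : ∀ τ, a τ ≤ a' τ) (t : ℕ) :
    (algState a (algRule α β) t).1 ≤ (algState a' (algRule α β) t).1 := by
  have state_snd : ∀ b t, (algState b (algRule α β) t).2 =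
      algRule α β (algState b (algRule α β) t).1 0 := by
    intro b t
    cases t <;> rfl
  induction t with
  | zero => exact h 0
  | succ t ih =>
    refine Nat.add_le_add ?_ (h (t + 1))
    rw [state_snd, state_snd]
    exact monotone_sub_algRule hα hβ 0 ih

/-- `alg` is monotone for unit-size jobs: if `a'` is identical to
`a` except for one extra job at a single time `t₀`, and no jobs arrive after
`t₀` in either sequence, then the backlog of `alg` run on `a` is at every time
at most the backlog of `alg` run on `a'`. -/
theorem alg_monotone (α β : ℝ) (hα : 1 ≤ α) (hβ : 1 ≤ β)
    (a a' : ℕ → ℕ) (t₀ : ℕ)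
    (hextra : a' t₀ = a t₀ + 1)
    (hsame : ∀ τ, τ ≠ t₀ → a' τ = a τ)
    (hlast : ∀ τ, t₀ < τ → a τ = 0) :
    ∀ t, backlog a (algSched a (algRule α β)) t ≤
      backlog a' (algSched a' (algRule α β)) t := by
  intro t
  have hg : ∀ n p, algRule α β n p ≤ n := fun n p => min_le_left _ _
  rw [backlog_algSched _ _ hg, backlog_algSched _ _ hg]
  refine algState_algRule_mono (by linarith) (by linarith) (fun τ => ?_) t
  by_cases hτ : τ = t₀
  · subst hτ
    omega
  · exact (hsame τ hτ).ge
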